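/- arXiv:2306.11328 — 2 statements merged into one kernel-verified Lean document; each statement's English description precedes it below -/
import Mathlib

section
/- Let a and b be positive integers with a ≥ b+2 and 2(a+b) ≤ n−3. Then Mo(C_{n,a−1,b+1}) < Mo(C_{n,a,b}). -/
open Finset SimpleGraph

open scoped Classical

/-- ψ(uv) = |n_u - n_v| for an edge, as a symmetric function on `Sym2 V`. -/
noncomputable def mostarPsi {V : Type*} [Fintype V] (G : SimpleGraph V) : Sym2 V → ℕ :=
  Sym2.lift ⟨fun u v =>
    (((Finset.univ.filter fun w => G.dist w u < G.dist w v).card : ℤ) -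
      ((Finset.univ.filter fun w => G.dist w v < G.dist w u).card : ℤ)).natAbs,
    fun u v => by dsimp only; omega⟩

/-- The Mostar index of a graph. -/
noncomputable def mostar {V : Type*} [Fintype V] (G : SimpleGraph V) : ℕ :=
  ∑ e ∈ G.edgeFinset, mostarPsi G e

/-- The graph on `Fin n` determined by a parent function. -/
def parentGraph (n : ℕ) (p : ℕ → ℕ) : SimpleGraph (Fin n) :=
  SimpleGraph.fromRel (fun u v => p u.val = v.val)

/-- S_{n,r}: r pendent paths of almost equal lengths at a common vertex. -/
def spiderS (n r : ℕ) : SimpleGraph (Fin n) :=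
  parentGraph n (fun v => if v ≤ r then 0 else v - r)

/-- The star on n vertices. -/
def starG (n : ℕ) : SimpleGraph (Fin n) :=
  parentGraph n (fun _ => 0)

/-- C_{n,a,b}. -/
def catC (n a b : ℕ) : SimpleGraph (Fin n) :=
  parentGraph n (fun v =>
    if v < n - a - b then v - 1
    else if v < n - b then v - (n - a - b) + 1
    else v - a - b - 1)

/-- F_{n,a,b}. -/
def catF (n a b : ℕ) : SimpleGraph (Fin n) :=
  parentGraph n (fun v =>
    if v < n - a - b - 2 then v - 1
    else if v = n - a - b - 2 then 1
    else if v < n - b then v - (n - a - b - 2)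
    else v - a - b - 3)

/-- A^r_{n,a,b}. -/
def treeA (n r a b : ℕ) : SimpleGraph (Fin n) :=
  parentGraph n (fun v =>
    if v < n - (a + b) * r then v - 1
    else if v < n - b * r then (if (v - (n - (a + b) * r)) % r = 0 then 0 else v - 1)
    else (if (v - (n - b * r)) % r = 0 then n - (a + b) * r - 1 else v - 1))

/-- S^r_{n,k}: k pendent paths of length r and n - k*r - 1 pendent edges at a common vertex. -/
def treeSrk (n r k : ℕ) : SimpleGraph (Fin n) :=
  parentGraph n (fun v =>
    if v < n - k * r then 0
    else if (v - (n - k * r)) % r = 0 then 0 else v - 1)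

/-- Number of vertices of odd degree. -/
noncomputable def oddDegreeCount {V : Type*} [Fintype V] (G : SimpleGraph V) : ℕ :=
  (Finset.univ.filter fun v => Odd (G.degree v)).card

/-- Number of vertices of degree two. -/
noncomputable def degreeTwoCount {V : Type*} [Fintype V] (G : SimpleGraph V) : ℕ :=
  (Finset.univ.filter fun v => G.degree v = 2).card

/-- Number of branch vertices (degree at least three). -/
noncomputable def branchCount {V : Type*} [Fintype V] (G : SimpleGraph V) : ℕ :=
  (Finset.univ.filter fun v => 3 ≤ G.degree v).card

/-- Number of pendent paths of length r in G. -/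
noncomputable def pendentPathCount {V : Type*} [Fintype V] (G : SimpleGraph V) (r : ℕ) : ℕ :=
  Nat.card { u : Fin (r + 1) → V //
    Function.Injective u ∧
    (∀ i : Fin r, G.Adj (u i.castSucc) (u i.succ)) ∧
    G.degree (u 0) = 1 ∧ 2 ≤ G.degree (u (Fin.last r)) ∧
    ∀ i : Fin (r + 1), i ≠ 0 → i ≠ Fin.last r → G.degree (u i) = 2 }


/-- The parent function of the caterpillar. -/
def catPar (n a b v : ℕ) : ℕ :=
  if v < n - a - b then v - 1
  else if v < n - b then v - (n - a - b) + 1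
  else v - a - b - 1

/-- Spine position. -/
def catPos (n a b v : ℕ) : ℕ :=
  if v < n - a - b then v else catPar n a b v

theorem catC_adj (n a b : ℕ) (u v : Fin n) :
    (catC n a b).Adj u v ↔ u ≠ v ∧ (catPar n a b u = v ∨ catPar n a b v = u) := by
  simp [catC, parentGraph, catPar]

theorem dist_lt_of_cut {V : Type*} (G : SimpleGraph V) (hG : G.Connected) (S : Set V) (u v : V)
    (h : ∀ x y, G.Adj x y → x ∈ S → y ∉ S → x = u ∧ y = v) (hv : v ∉ S) (w : V) (hw : w ∈ S) :
    G.dist w u < G.dist w v := by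
  have key : ∀ (w t : V) (q : G.Walk w t), w ∈ S → t ∉ S → G.dist w u < q.length := by
    intro w t q
    induction q with
    | nil => intro h1 h2; exact absurd h1 h2
    | @cons x y z hxy q ih =>
      intro h1 h2
      by_cases hy : y ∈ S
      · have h3 := ih hy h2
        have h4 := hG.dist_triangle (u := x) (v := y) (w := u)
        have h5 : G.dist x y = 1 := SimpleGraph.dist_eq_one_iff_adj.2 hxy
        rw [SimpleGraph.Walk.length_cons]
        omega
      · obtain ⟨rfl, rfl⟩ := h x y hxy h1 hy
        simp
  obtain ⟨q, hq⟩ := hG.exists_walk_length_eq_dist w v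
  rw [← hq]
  exact key w v q hw hv

theorem psi_of_cut {V : Type*} [Fintype V] (G : SimpleGraph V) (hG : G.Connected)
    (P : V → Prop) [DecidablePred P] (u v : V)
    (h : ∀ x y, G.Adj x y → P x → ¬ P y → x = u ∧ y = v) (hu : P u) (hv : ¬ P v) :
    mostarPsi G s(v, u) =
      ((Fintype.card V : ℤ) - 2 * ((Finset.univ.filter P).card : ℤ)).natAbs := by
  have h1 : ∀ w, P w → G.dist w u < G.dist w v :=
    fun w hw => dist_lt_of_cut G hG {x | P x} u v h hv w hw
  have h2 : ∀ w, ¬ P w → G.dist w v < G.dist w u := fun w hw =>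
    dist_lt_of_cut G hG {x | ¬ P x} v u
      (fun x y hxy hx hy => (h y x hxy.symm (not_not.1 hy) hx).symm) (fun h => h hu) w hw
  have e1 : (Finset.univ.filter fun w => G.dist w u < G.dist w v) = Finset.univ.filter P := by
    ext w
    simp only [Finset.mem_filter, Finset.mem_univ, true_and]
    refine ⟨fun hh => ?_, h1 w⟩
    by_contra hc
    have := h2 w hc
    omega
  have e2 : (Finset.univ.filter fun w => G.dist w v < G.dist w u)
      = Finset.univ.filter (fun w => ¬ P w) := by
    ext w
    simp only [Finset.mem_filter, Finset.mem_univ, true_and]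
    refine ⟨fun hh hc => ?_, h2 w⟩
    have := h1 w hc
    omega
  have e3 := Finset.card_filter_add_card_filter_not (s := (Finset.univ : Finset V)) P
  rw [Finset.card_univ] at e3
  simp only [mostarPsi, Sym2.lift_mk]
  rw [e1, e2]
  omega

theorem catC_connected (n m a b : ℕ) (hn : n = m + a + b) (hm : a + b + 1 ≤ m) (hm2 : 2 ≤ m) :
    (catC n a b).Connected := by
  have h0 : 0 < n := by omega
  have key : ∀ k (hk : k < n), (catC n a b).Reachable ⟨k, hk⟩ ⟨0, h0⟩ := by
    intro k
    induction k using Nat.strong_induction_on with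
    | _ k ih =>
      intro hk
      by_cases hk0 : k = 0
      · subst hk0; rfl
      · have hp : catPar n a b k < k := by
          unfold catPar; split_ifs <;> omega
        have hadj : (catC n a b).Adj ⟨k, hk⟩ ⟨catPar n a b k, hp.trans hk⟩ := by
          rw [catC_adj]
          refine ⟨fun h => ?_, Or.inl rfl⟩
          have := congrArg Fin.val h
          simp only at this
          omega
        exact hadj.reachable.trans (ih _ hp _)
  have : Nonempty (Fin n) := ⟨⟨0, h0⟩⟩
  exact ⟨fun u v => (key u u.2).trans (key v v.2).symm⟩

theorem sum_ind (N c k : ℕ) :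
    (∑ j ∈ Finset.range N, if c + j < k then 1 else 0) = min N (k - c) := by
  induction N with
  | zero => simp
  | succ N ih =>
    rw [Finset.sum_range_succ, ih]
    split_ifs <;> omega

theorem card_left (n m a b k : ℕ) (hn : n = m + a + b) (hm : a + b + 1 ≤ m) (hk : k < m) :
    (Finset.univ.filter fun w : Fin n => catPos n a b w < k).card
      = k + min a (k - 1) + min b (k - (m - b - 1)) := by
  rw [Finset.card_filter, Fin.sum_univ_eq_sum_range (fun w => if catPos n a b w < k then 1 else 0)]
  have e : Finset.range n = Finset.range (m + a + b) := by rw [hn]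
  rw [e, Finset.sum_range_add, Finset.sum_range_add]
  have s1 : (∑ x ∈ Finset.range m, if catPos n a b x < k then 1 else 0) = min m (k - 0) := by
    rw [← sum_ind]
    refine Finset.sum_congr rfl fun x hx => ?_
    have hx := Finset.mem_range.1 hx
    have : catPos n a b x = 0 + x := by unfold catPos; split_ifs <;> omega
    rw [this]
  have s2 : (∑ x ∈ Finset.range a, if catPos n a b (m + x) < k then 1 else 0)
      = min a (k - 1) := by
    rw [← sum_ind]
    refine Finset.sum_congr rfl fun x hx => ?_
    have hx := Finset.mem_range.1 hx
    have : catPos n a b (m + x) = 1 + x := by unfold catPos catPar; split_ifs <;> omega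
    rw [this]
  have s3 : (∑ x ∈ Finset.range b, if catPos n a b (m + a + x) < k then 1 else 0)
      = min b (k - (m - b - 1)) := by
    rw [← sum_ind]
    refine Finset.sum_congr rfl fun x hx => ?_
    have hx := Finset.mem_range.1 hx
    have : catPos n a b (m + a + x) = m - b - 1 + x := by
      unfold catPos catPar; split_ifs <;> omega
    rw [this]
  rw [s1, s2, s3]
  omega

/-- Edge contribution. -/
def catF' (n m a b k : ℕ) : ℕ :=
  if k = 0 then 0 else
  ((n : ℤ) - 2 * ((k + min a (k - 1) + min b (k - (m - b - 1)) : ℕ) : ℤ)).natAbs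

theorem psi_spine (n m a b : ℕ) (hn : n = m + a + b) (hm : a + b + 1 ≤ m) (hm2 : 2 ≤ m)
    (u v : Fin n) (hv0 : v.val ≠ 0) (hv : v.val < m) (hu : catPar n a b v = u) :
    mostarPsi (catC n a b) s(v, u) = catF' n m a b v := by
  rw [psi_of_cut (catC n a b) (catC_connected n m a b hn hm hm2)
    (fun w : Fin n => catPos n a b w < v) u v]
  · rw [card_left n m a b v hn hm hv, Fintype.card_fin, catF', if_neg hv0]
  · intro x y hxy hx hy
    rw [catC_adj] at hxy
    obtain ⟨hne, hxy⟩ := hxy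
    rw [Ne, Fin.ext_iff] at hne
    rw [Fin.ext_iff, Fin.ext_iff, ← hu]
    have := x.2
    have := y.2
    unfold catPos catPar at *
    grind
  · rw [← hu]; unfold catPos catPar; split_ifs <;> omega
  · unfold catPos; split_ifs <;> omega

theorem psi_leg (n m a b : ℕ) (hn : n = m + a + b) (hm : a + b + 1 ≤ m) (hm2 : 2 ≤ m)
    (u v : Fin n) (hv : m ≤ v.val) (hu : catPar n a b v = u) :
    mostarPsi (catC n a b) s(v, u) = n - 2 := by
  have hlt : ∀ x : Fin n, catPar n a b x < m := by
    intro x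
    have := x.2
    unfold catPar; split_ifs <;> omega
  rw [psi_of_cut (catC n a b) (catC_connected n m a b hn hm hm2)
    (fun w : Fin n => w ≠ v) u v]
  · rw [Finset.filter_ne', Finset.card_erase_of_mem (Finset.mem_univ _), Finset.card_univ,
      Fintype.card_fin]
    omega
  · intro x y hxy hx hy
    rw [catC_adj] at hxy
    obtain ⟨hne, hxy⟩ := hxy
    have hy := not_not.1 hy
    subst hy
    refine ⟨?_, rfl⟩
    rw [Fin.ext_iff]
    have := hlt x
    omega
  · rw [Ne, Fin.ext_iff]; have := hlt v; omega
  · simp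

theorem mostar_eq (n m a b : ℕ) (hn : n = m + a + b) (hm : a + b + 1 ≤ m) (hm2 : 2 ≤ m) :
    mostar (catC n a b) = ∑ k ∈ Finset.range m, catF' n m a b k + (a + b) * (n - 2) := by
  have hlt : ∀ k, k < n → catPar n a b k < n := by
    intro x hx
    unfold catPar; split_ifs <;> omega
  have hlt' : ∀ k, k ≠ 0 → k < n → catPar n a b k < k := by
    intro x h0 hx
    unfold catPar; split_ifs <;> omega
  have h0 : 0 < n := by omega
  let P : Fin n → Fin n := fun v => ⟨catPar n a b v, hlt v v.2⟩
  let f : ℕ → ℕ := fun k => if k < m then catF' n m a b k else n - 2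
  have step : mostar (catC n a b)
      = ∑ v ∈ (Finset.univ.filter fun v : Fin n => v.val ≠ 0), f v := by
    unfold mostar
    symm
    refine Finset.sum_bij (fun v _ => s(v, P v)) ?_ ?_ ?_ ?_
    · intro v hv
      have hv := (Finset.mem_filter.1 hv).2
      rw [SimpleGraph.mem_edgeFinset, SimpleGraph.mem_edgeSet, catC_adj]
      refine ⟨fun h => ?_, Or.inl rfl⟩
      have h1 := congrArg Fin.val h
      have h2 := hlt' v hv v.2
      simp only [P] at h1
      omega
    · intro v hv w hw h
      have hv := (Finset.mem_filter.1 hv).2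
      have hw := (Finset.mem_filter.1 hw).2
      rw [Sym2.eq_iff] at h
      rcases h with h | ⟨h1, h2⟩
      · exact h.1
      · have h1 := congrArg Fin.val h1
        have h2 := congrArg Fin.val h2
        have h3 := hlt' v hv v.2
        have h4 := hlt' w hw w.2
        simp only [P] at h1 h2
        omega
    · intro e he
      induction e using Sym2.ind with
      | _ x y =>
        rw [SimpleGraph.mem_edgeFinset, SimpleGraph.mem_edgeSet, catC_adj] at he
        obtain ⟨hne, he⟩ := he
        have hp0 : catPar n a b 0 = 0 := by unfold catPar; split_ifs <;> omega
        rw [Ne, Fin.ext_iff] at hne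
        rcases he with he | he
        · refine ⟨x, ?_, ?_⟩
          · simp only [Finset.mem_filter, Finset.mem_univ, true_and]
            intro hx
            rw [hx, hp0] at he
            omega
          · have : P x = y := Fin.ext he
            rw [this]
        · refine ⟨y, ?_, ?_⟩
          · simp only [Finset.mem_filter, Finset.mem_univ, true_and]
            intro hx
            rw [hx, hp0] at he
            omega
          · have : P y = x := Fin.ext he
            rw [this, Sym2.eq_swap]
    · intro v hv
      have hv := (Finset.mem_filter.1 hv).2
      by_cases hvm : v.val < m
      · rw [psi_spine n m a b hn hm hm2 (P v) v hv hvm rfl]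
        simp only [f, if_pos hvm]
      · rw [psi_leg n m a b hn hm hm2 (P v) v (by omega) rfl]
        simp only [f, if_neg hvm]
  rw [step, Finset.sum_filter_of_ne, Fin.sum_univ_eq_sum_range f]
  · have e : Finset.range n = Finset.range (m + (a + b)) := by rw [hn, add_assoc]
    rw [e, Finset.sum_range_add]
    congr 1
    · refine Finset.sum_congr rfl fun x hx => ?_
      simp only [f, if_pos (Finset.mem_range.1 hx)]
    · rw [Finset.sum_congr rfl (g := fun _ => n - 2)]
      · simp
      · intro x _
        simp [f]
  · intro v _ hv h0
    apply hv
    simp only [f, h0, catF']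
    simp
    omega

theorem tele (n m a b : ℕ) (hn : n = m + (a + 1) + b) (hm : a + 1 + b + 3 ≤ m) (t : ℕ)
    (ht : t ≤ m) :
    ((∑ k ∈ Finset.range t, catF' n m (a + 1) b k : ℕ) : ℤ)
      - ((∑ k ∈ Finset.range t, catF' n m a (b + 1) k : ℕ) : ℤ)
    = |(n : ℤ) - 2 * ((min (max t (a + 2)) (m - b - 1) + a : ℕ) : ℤ)|
      - |(n : ℤ) - 4 * ((a : ℤ) + 1)| := by
  induction t with
  | zero =>
    have : min (max 0 (a + 2)) (m - b - 1) + a = 2 * (a + 1) := by omega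
    rw [this]
    push_cast
    simp only [Finset.range_zero, Finset.sum_empty]
    ring_nf
  | succ t ih =>
    have ih := ih (by omega)
    rw [Finset.sum_range_succ, Finset.sum_range_succ]
    simp only [Nat.cast_add] at ih ⊢
    have key : ((catF' n m (a + 1) b t : ℕ) : ℤ) - (catF' n m a (b + 1) t : ℕ)
      = |(n : ℤ) - 2 * ((min (max (t + 1) (a + 2)) (m - b - 1) + a : ℕ) : ℤ)|
       - |(n : ℤ) - 2 * ((min (max t (a + 2)) (m - b - 1) + a : ℕ) : ℤ)| := by
      unfold catF'
      by_cases h1 : t < a + 2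
      · have e1 : min (max (t + 1) (a + 2)) (m - b - 1) = min (max t (a + 2)) (m - b - 1) := by
          omega
        have e2 : t + min (a + 1) (t - 1) + min b (t - (m - b - 1))
          = t + min a (t - 1) + min (b + 1) (t - (m - (b + 1) - 1)) := by omega
        rw [e1, e2]; ring
      · by_cases h2 : t < m - b - 1
        · rw [if_neg (by omega), if_neg (by omega), Int.natCast_natAbs, Int.natCast_natAbs]
          have e1 : t + min (a + 1) (t - 1) + min b (t - (m - b - 1))
            = min (max (t + 1) (a + 2)) (m - b - 1) + a := by omega
          have e2 : t + min a (t - 1) + min (b + 1) (t - (m - (b + 1) - 1))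
            = min (max t (a + 2)) (m - b - 1) + a := by omega
          rw [e1, e2]
        · have e1 : min (max (t + 1) (a + 2)) (m - b - 1) = min (max t (a + 2)) (m - b - 1) := by
            omega
          have e2 : t + min (a + 1) (t - 1) + min b (t - (m - b - 1))
            = t + min a (t - 1) + min (b + 1) (t - (m - (b + 1) - 1)) := by omega
          rw [e1, e2]; ring
    simp only [Nat.cast_add] at key
    linarith

/-- for positive integers a, b with a ≥ b+2 and 2(a+b) ≤ n-3,
Mo(C_{n,a-1,b+1}) < Mo(C_{n,a,b}). -/
theorem mostar_catC_lt (n a b : ℕ) (hb : 1 ≤ b) (hab : b + 2 ≤ a)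
    (hn : 2 * (a + b) ≤ n - 3) (hn' : 3 ≤ n) :
    mostar (catC n (a - 1) (b + 1)) < mostar (catC n a b) := by
  obtain ⟨a, rfl⟩ : ∃ c, a = c + 1 := ⟨a - 1, by omega⟩
  obtain ⟨m, hm⟩ : ∃ m, n = m + (a + 1) + b := ⟨n - (a + 1) - b, by omega⟩
  rw [Nat.add_sub_cancel, mostar_eq n m a (b + 1) (by omega) (by omega) (by omega),
    mostar_eq n m (a + 1) b hm (by omega) (by omega)]
  have h := tele n m a b hm (by omega) m le_rfl
  have e : min (max m (a + 2)) (m - b - 1) + a = m - b - 1 + a := by omega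
  rw [e] at h
  have e3 : a + (b + 1) = a + 1 + b := by omega
  rw [e3]
  have hlt : |(n : ℤ) - 4 * ((a : ℤ) + 1)| < |(n : ℤ) - 2 * ((m - b - 1 + a : ℕ) : ℤ)| := by
    rw [Int.abs_eq_natAbs, Int.abs_eq_natAbs]
    omega
  omega
end

section
/- Let n and k be integers with 1 ≤ k ≤ ⌊n/2⌋, and let T be a tree of order n with exactly 2k vertices of odd degree that has the maximum Mostar index among all such trees. Then T is isomorphic to S_{n,2k} (where, if k = n/2, S_{n,n} is understood to be the star S_n). -/
open Finset SimpleGraph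

open scoped Classical

/-! ### Rooted trees -/

/-- `p` is the parent function of the tree `T` rooted at `c`. -/
def IsPar {V : Type*} (T : SimpleGraph V) (c : V) (p : V → V) : Prop :=
  (∀ v, v ≠ c → T.Adj v (p v) ∧ T.dist c v = T.dist c (p v) + 1) ∧
  ∀ u v, T.Adj u v → (u ≠ c ∧ p u = v) ∨ (v ≠ c ∧ p v = u)

theorem closer_unique {V : Type*} {T : SimpleGraph V} (hT : T.IsTree) {w x y z : V}
    (hx : T.Adj x y) (hz : T.Adj z y) (dx : T.dist w y = T.dist w x + 1)
    (dz : T.dist w y = T.dist w z + 1) : x = z := by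
  obtain ⟨q1, h1⟩ := hT.connected.exists_walk_length_eq_dist w x
  obtain ⟨q2, h2⟩ := hT.connected.exists_walk_length_eq_dist w z
  have i1 : (q1.concat hx).IsPath :=
    Walk.isPath_of_length_eq_dist _ (by rw [Walk.length_concat, h1, dx])
  have i2 : (q2.concat hz).IsPath :=
    Walk.isPath_of_length_eq_dist _ (by rw [Walk.length_concat, h2, dz])
  have h := (hT.existsUnique_path w y).unique i1 i2
  have := congrArg Walk.penultimate h
  simpa using this

theorem exists_isPar {V : Type*} {T : SimpleGraph V} (hT : T.IsTree) (c : V) :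
    ∃ p, IsPar T c p := by
  have key : ∀ v, ∃ u, v ≠ c → T.Adj v u ∧ T.dist c v = T.dist c u + 1 := by
    intro v
    by_cases hv : v = c
    · exact ⟨v, fun h => absurd hv h⟩
    · obtain ⟨q, hq⟩ := hT.connected.exists_walk_length_eq_dist v c
      cases q with
      | nil => exact absurd rfl hv
      | cons h q' =>
        rename_i u
        refine ⟨u, fun _ => ⟨h, ?_⟩⟩
        have h1 := SimpleGraph.dist_le q'
        rw [Walk.length_cons] at hq
        rw [T.dist_comm (u := c) (v := v), T.dist_comm (u := c) (v := u)]
        rcases hT.dist_eq_dist_add_one_of_adj c h with h2 | h2 <;>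
        rw [T.dist_comm (u := c) (v := v), T.dist_comm (u := c) (v := u)] at h2 <;> omega
  choose p hp using key
  refine ⟨p, hp, ?_⟩
  intro u v huv
  rcases hT.dist_eq_dist_add_one_of_adj c huv with h | h
  · left
    have hu : u ≠ c := by rintro rfl; simp at h
    exact ⟨hu, closer_unique hT (hp u hu).1.symm huv.symm (hp u hu).2 h⟩
  · right
    have hv : v ≠ c := by rintro rfl; simp at h
    exact ⟨hv, closer_unique hT (hp v hv).1.symm huv (hp v hv).2 h⟩

section par
set_option linter.unusedSectionVars false
variable {V : Type*} [Fintype V] {T : SimpleGraph V} {c : V} {p : V → V}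

theorem IsPar.adj_iff (h : IsPar T c p) (u v : V) :
    T.Adj u v ↔ (u ≠ c ∧ p u = v) ∨ (v ≠ c ∧ p v = u) := by
  refine ⟨h.2 u v, ?_⟩
  rintro (⟨h1, rfl⟩ | ⟨h1, rfl⟩)
  · exact (h.1 u h1).1
  · exact (h.1 v h1).1.symm

theorem IsPar.degree_eq (h : IsPar T c p) (v : V) :
    T.degree v = (univ.filter fun u => u ≠ c ∧ p u = v).card + if v = c then 0 else 1 := by
  rw [← card_neighborFinset_eq_degree]
  have e : T.neighborFinset v = (univ.filter fun u => u ≠ c ∧ p u = v) ∪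
      (if v = c then ∅ else {p v}) := by
    ext u
    rw [mem_neighborFinset, h.adj_iff]
    by_cases hv : v = c <;> simp [hv, eq_comm]
  rw [e, card_union_of_disjoint]
  · by_cases hv : v = c <;> simp [hv]
  · by_cases hv : v = c
    · simp [hv]
    · simp only [hv, if_false, Finset.disjoint_singleton_right, mem_filter, mem_univ, true_and,
        not_and]
      intro h1 h2
      have a := (h.1 v hv).2
      have b := (h.1 _ h1).2
      rw [h2] at b
      omega

theorem IsPar.sum_degree (h : IsPar T c p) (g : V → ℤ) :
    ∑ v, (T.degree v : ℤ) * g v = ∑ v ∈ univ.erase c, (g v + g (p v)) := by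
  have h1 : ∀ v, (T.degree v : ℤ) * g v =
      (∑ u ∈ (univ.erase c).filter (fun u => p u = v), g (p u)) + if v = c then 0 else g v := by
    intro v
    rw [h.degree_eq v]
    have : ∑ u ∈ (univ.erase c).filter (fun u => p u = v), g (p u) =
        ∑ u ∈ (univ.filter fun u => u ≠ c ∧ p u = v), g v := by
      apply Finset.sum_congr
      · ext u; simp
      · intro u hu; rw [(mem_filter.mp hu).2.2]
    rw [this, Finset.sum_const]
    by_cases hv : v = c <;> simp [hv, add_mul]
  rw [Finset.sum_congr rfl (fun v _ => h1 v), Finset.sum_add_distrib, Finset.sum_add_distrib,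
    add_comm]
  have h2 := Finset.sum_fiberwise (univ.erase c) p (fun u => g (p u))
  refine congrArg₂ (· + ·) ?_ h2
  rw [← Finset.sum_erase (a := c) (f := fun x => if x = c then 0 else g x)]
  · apply Finset.sum_congr rfl
    intro v hv
    simp [(mem_erase.mp hv).1]
  · simp

theorem IsPar.sum_diff (h : IsPar T c p) (g : V → ℤ) :
    ∑ v ∈ univ.erase c, (g v - g (p v)) = ∑ v, (2 - (T.degree v : ℤ)) * g v - 2 * g c := by
  have h1 := h.sum_degree g
  have h2 : ∑ v, g v = ∑ v ∈ univ.erase c, g v + g c := by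
    rw [Finset.sum_erase_add _ _ (mem_univ c)]
  simp only [sub_mul, Finset.sum_sub_distrib, ← Finset.mul_sum, Finset.sum_add_distrib] at *
  linarith

theorem IsPar.sum_dist (hT : T.IsTree) (h : IsPar T c p) (w : V) :
    ∑ v ∈ univ.erase c, ((T.dist w v : ℤ) - T.dist w (p v)) =
      (Fintype.card V : ℤ) - 1 - 2 * T.dist w c := by
  rw [h.sum_diff (fun v => (T.dist w v : ℤ))]
  obtain ⟨q, hq⟩ := exists_isPar hT w
  have h1 := hq.sum_diff (fun v => (T.dist w v : ℤ))
  simp only [dist_self] at h1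
  have h2 : ∑ v ∈ univ.erase w, ((T.dist w v : ℤ) - T.dist w (q v)) =
      ∑ v ∈ univ.erase w, (1 : ℤ) := by
    apply Finset.sum_congr rfl
    intro v hv
    have := (hq.1 v (mem_erase.mp hv).1).2
    rw [this]; push_cast; ring
  have hc : 1 ≤ Fintype.card V := Fintype.card_pos_iff.mpr ⟨c⟩
  rw [h2, Finset.sum_const, card_erase_of_mem (mem_univ _), Finset.card_univ] at h1
  simp only [nsmul_eq_mul, Nat.cast_sub hc] at h1
  push_cast at h1
  linarith

/-- Total distance to `v`. -/
noncomputable def totD (T : SimpleGraph V) (v : V) : ℤ := ∑ w, (T.dist w v : ℤ)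

theorem IsPar.sum_totD (hT : T.IsTree) (h : IsPar T c p) :
    ∑ v ∈ univ.erase c, (totD T v - totD T (p v)) =
      (Fintype.card V : ℤ) * (Fintype.card V - 1) - 2 * totD T c := by
  unfold totD
  simp only [← Finset.sum_sub_distrib]
  rw [Finset.sum_comm]
  rw [Finset.sum_congr rfl (fun w _ => h.sum_dist hT w)]
  simp [Finset.sum_sub_distrib, Finset.mul_sum]
  ring

theorem psi_eq (hT : T.IsTree) {u v : V} (huv : T.Adj u v) :
    (mostarPsi T s(u, v) : ℤ) = |totD T u - totD T v| := by
  have h : totD T u - totD T v =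
      ((Finset.univ.filter fun w => T.dist w v < T.dist w u).card : ℤ) -
      ((Finset.univ.filter fun w => T.dist w u < T.dist w v).card : ℤ) := by
    unfold totD
    rw [Finset.card_filter, Finset.card_filter]
    push_cast
    rw [← Finset.sum_sub_distrib, ← Finset.sum_sub_distrib]
    apply Finset.sum_congr rfl
    intro w _
    rcases hT.dist_eq_dist_add_one_of_adj w huv with h | h <;> rw [h] <;> simp
  rw [h]
  simp only [mostarPsi, Sym2.lift_mk]
  rw [Int.natCast_natAbs, abs_sub_comm]

theorem IsPar.mostar_eq (hT : T.IsTree) (h : IsPar T c p) :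
    (mostar T : ℤ) = ∑ v ∈ univ.erase c, |totD T v - totD T (p v)| := by
  have e : T.edgeFinset = (univ.erase c).image (fun v => s(v, p v)) := by
    ext x
    induction x with
    | _ a b =>
      rw [mem_edgeFinset, mem_edgeSet, h.adj_iff]
      simp only [Finset.mem_image, mem_erase, mem_univ, and_true, Sym2.eq_iff]
      constructor
      · rintro (⟨h1, h2⟩ | ⟨h1, h2⟩)
        · exact ⟨a, h1, Or.inl ⟨rfl, h2⟩⟩
        · exact ⟨b, h1, Or.inr ⟨rfl, h2⟩⟩
      · rintro ⟨v, h1, (⟨rfl, h2⟩ | ⟨rfl, h2⟩)⟩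
        · exact Or.inl ⟨h1, h2⟩
        · exact Or.inr ⟨h1, h2⟩
  unfold mostar
  rw [e, Finset.sum_image]
  · push_cast
    apply Finset.sum_congr rfl
    intro v hv
    exact psi_eq hT (h.1 v (mem_erase.mp hv).1).1
  · intro a ha b hb hab
    have ha' := (h.1 a (by simpa using ha)).2
    have hb' := (h.1 b (by simpa using hb)).2
    rcases Sym2.eq_iff.mp hab with ⟨h1, _⟩ | ⟨h1, h2⟩
    · exact h1
    · rw [h2] at ha'; rw [← h1] at hb'; omega

theorem mostar_ge (hT : T.IsTree) (c : V) :
    (Fintype.card V : ℤ) * (Fintype.card V - 1) - 2 * totD T c ≤ mostar T := by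
  obtain ⟨p, h⟩ := exists_isPar hT c
  rw [h.mostar_eq hT, ← h.sum_totD hT]
  exact Finset.sum_le_sum fun v _ => le_abs_self _

theorem IsPar.totD_step (hT : T.IsTree) (h : IsPar T c p) {v : V} (hv : v ≠ c) (hpv : p v ≠ c) :
    totD T (p v) - totD T v ≤ totD T (p (p v)) - totD T (p v) := by
  unfold totD
  rw [← Finset.sum_sub_distrib, ← Finset.sum_sub_distrib]
  apply Finset.sum_le_sum
  intro w _
  have a1 := (h.1 v hv).1
  have a2 := (h.1 _ hpv).1
  rcases hT.dist_eq_dist_add_one_of_adj w a1 with h1 | h1 <;>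
  rcases hT.dist_eq_dist_add_one_of_adj w a2 with h2 | h2
  · omega
  · omega
  · have := closer_unique hT a1 a2.symm h1 h2
    have b1 := (h.1 v hv).2
    have b2 := (h.1 _ hpv).2
    rw [← this] at b2
    omega
  · omega

theorem mostar_centroid (hT : T.IsTree) :
    ∃ c, (mostar T : ℤ) = (Fintype.card V : ℤ) * (Fintype.card V - 1) - 2 * totD T c := by
  have hne : Nonempty V := hT.connected.nonempty
  obtain ⟨c, hc⟩ := Finite.exists_min (totD T)
  obtain ⟨p, h⟩ := exists_isPar hT c
  refine ⟨c, ?_⟩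
  rw [h.mostar_eq hT, ← h.sum_totD hT]
  apply Finset.sum_congr rfl
  intro v hv
  apply abs_of_nonneg
  have key : ∀ m : ℕ, ∀ v, v ≠ c → T.dist c v ≤ m → totD T (p v) ≤ totD T v := by
    intro m
    induction m with
    | zero =>
      intro v hv hd
      have := (h.1 v hv).2
      omega
    | succ m ih =>
      intro v hv hd
      by_cases hpv : p v = c
      · rw [hpv]; exact hc v
      · have := (h.1 v hv).2
        have h1 := ih (p v) hpv (by omega)
        have h2 := h.totD_step hT hv hpv
        omega
  have := key _ v (mem_erase.mp hv).1 le_rfl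
  omega

end par

section levels
set_option linter.unusedSectionVars false
variable {V : Type*} [Fintype V] {T : SimpleGraph V} {c : V} {p : V → V}

theorem dist_lt_card_tree (hT : T.IsTree) (u v : V) : T.dist u v < Fintype.card V := by
  obtain ⟨q, hq, hl⟩ := hT.connected.exists_path_of_dist u v
  rw [← hl]
  exact hq.length_lt

theorem IsPar.exists_child (h : IsPar T c p) {v : V} (hv : v ≠ c) (hd : T.degree v ≠ 1) :
    ∃ u, u ≠ c ∧ p u = v := by
  by_contra hcon
  push Not at hcon
  apply hd
  rw [h.degree_eq v, if_neg hv, filter_eq_empty_iff.mpr]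
  · simp
  · intro u _ hu
    exact hcon u hu.1 hu.2

theorem IsPar.level_le_leaves (hT : T.IsTree) (h : IsPar T c p) (j : ℕ) :
    ∀ i, 1 ≤ i → Fintype.card V ≤ i + j →
    (univ.filter fun v => T.dist c v = i).card ≤
      (univ.filter fun v => T.degree v = 1 ∧ i ≤ T.dist c v).card := by
  induction j with
  | zero =>
    intro i _ hi
    rw [filter_eq_empty_iff.mpr]
    · simp
    · intro v _
      have := dist_lt_card_tree hT c v
      omega
  | succ j ih =>
    intro i hi hj
    have ih' := ih (i + 1) (by omega) (by omega)
    have h1 : (univ.filter fun v => T.dist c v = i ∧ T.degree v ≠ 1).card ≤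
        (univ.filter fun v => T.dist c v = i + 1).card := by
      apply Finset.card_le_card_of_surjOn p
      intro v hv
      simp only [coe_filter, mem_univ, true_and, Set.mem_ofPred_eq] at hv
      have hvc : v ≠ c := by rintro rfl; simp at hv; omega
      obtain ⟨u, hu, rfl⟩ := h.exists_child hvc hv.2
      refine ⟨u, ?_, rfl⟩
      have := (h.1 u hu).2
      simp; omega
    have h2 : (univ.filter fun v => T.dist c v = i).card ≤
        (univ.filter fun v => T.dist c v = i ∧ T.degree v = 1).card +
        (univ.filter fun v => T.dist c v = i ∧ T.degree v ≠ 1).card := by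
      rw [← card_union_of_disjoint]
      · apply card_le_card
        intro v; simp; tauto
      · rw [Finset.disjoint_left]; intro v; simp; tauto
    have h3 : (univ.filter fun v => T.dist c v = i ∧ T.degree v = 1).card +
        (univ.filter fun v => T.degree v = 1 ∧ i + 1 ≤ T.dist c v).card ≤
        (univ.filter fun v => T.degree v = 1 ∧ i ≤ T.dist c v).card := by
      rw [← card_union_of_disjoint]
      · apply card_le_card
        intro v; simp; omega
      · rw [Finset.disjoint_left]; intro v; simp; omega
    omega

theorem IsPar.level_le (hT : T.IsTree) (h : IsPar T c p) {r : ℕ}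
    (hr : (univ.filter fun v => v ≠ c ∧ T.degree v = 1).card ≤ r) (i : ℕ) (hi : 1 ≤ i) :
    (univ.filter fun v => T.dist c v = i).card ≤ r := by
  refine (h.level_le_leaves hT (Fintype.card V) i hi (by omega)).trans (le_trans ?_ hr)
  apply card_le_card
  intro v
  simp only [mem_filter, mem_univ, true_and]
  rintro ⟨h1, h2⟩
  refine ⟨?_, h1⟩
  rintro rfl
  simp at h2; omega

theorem ball_succ (T : SimpleGraph V) (c : V) (i : ℕ) :
    (univ.filter fun v => T.dist c v ≤ i + 1).card =
    (univ.filter fun v => T.dist c v ≤ i).card + (univ.filter fun v => T.dist c v = i + 1).card := by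
  rw [← card_union_of_disjoint]
  · congr 1; ext v; simp; omega
  · rw [Finset.disjoint_left]; intro v; simp; omega

theorem ball_zero' (hT : T.IsTree) (c : V) :
    (univ.filter fun v => T.dist c v ≤ 0).card = 1 := by
  rw [card_eq_one]
  refine ⟨c, ?_⟩
  ext v
  simp [hT.connected.dist_eq_zero_iff, eq_comm]

theorem IsPar.ball_le (hT : T.IsTree) (h : IsPar T c p) {r : ℕ}
    (hr : (univ.filter fun v => v ≠ c ∧ T.degree v = 1).card ≤ r) (i : ℕ) :
    (univ.filter fun v => T.dist c v ≤ i).card ≤ 1 + i * r := by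
  induction i with
  | zero => rw [ball_zero' hT]; omega
  | succ i ih =>
    rw [ball_succ]
    have := h.level_le hT hr (i + 1) (by omega)
    rw [add_mul]; omega

theorem totD_eq (hT : T.IsTree) (c : V) :
    totD T c = ∑ i ∈ range (Fintype.card V),
      ((Fintype.card V : ℤ) - (univ.filter fun v => T.dist c v ≤ i).card) := by
  have h1 : ∀ w : V, (T.dist w c : ℤ) =
      ∑ i ∈ range (Fintype.card V), if T.dist c w ≤ i then (0 : ℤ) else 1 := by
    intro w
    rw [T.dist_comm]
    have := dist_lt_card_tree hT c w
    have h2 : ∑ i ∈ range (Fintype.card V), (if T.dist c w ≤ i then (0 : ℤ) else 1) =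
        ∑ i ∈ range (T.dist c w), (1 : ℤ) := by
      symm
      rw [← Finset.sum_subset (Finset.range_subset_range.mpr this.le)
        (f := fun i => if T.dist c w ≤ i then (0 : ℤ) else 1)]
      · apply Finset.sum_congr rfl
        intro i hi
        rw [if_neg]; simpa using hi
      · intro i _ hi
        rw [if_pos]; simpa using hi
    rw [h2]; simp
  unfold totD
  rw [Finset.sum_congr rfl (fun w _ => h1 w), Finset.sum_comm]
  apply Finset.sum_congr rfl
  intro i _
  rw [Finset.card_filter]
  push_cast
  rw [← Finset.card_univ, Finset.card_eq_sum_ones]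
  push_cast
  rw [← Finset.sum_sub_distrib]
  apply Finset.sum_congr rfl
  intro v _
  split_ifs <;> simp

/-- Small total distance forces the ball sizes. -/
theorem IsPar.ball_eq (hT : T.IsTree) (h : IsPar T c p) {r : ℕ}
    (hr : (univ.filter fun v => v ≠ c ∧ T.degree v = 1).card ≤ r)
    (hD : totD T c ≤ ∑ i ∈ range (Fintype.card V),
      ((Fintype.card V : ℤ) - (min (Fintype.card V) (1 + i * r) : ℕ)))
    (i : ℕ) (hi : i < Fintype.card V) :
    (univ.filter fun v => T.dist c v ≤ i).card = min (Fintype.card V) (1 + i * r) := by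
  have h1 : ∀ i, (univ.filter fun v => T.dist c v ≤ i).card ≤ min (Fintype.card V) (1 + i * r) :=
    fun i => le_min (card_le_univ _) (h.ball_le hT hr i)
  rw [totD_eq hT] at hD
  by_contra hne
  have h2 := lt_of_le_of_ne (h1 i) hne
  refine absurd hD (not_le.mpr ?_)
  apply Finset.sum_lt_sum
  · intro j _
    have := h1 j
    omega
  · refine ⟨i, mem_range.mpr hi, ?_⟩
    omega

/-- If all the non-root leaves are at most as many as the root's neighbours, the tree is a
spider. -/
theorem IsPar.injOn (hT : T.IsTree) (h : IsPar T c p)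
    (hr : (univ.filter fun v => v ≠ c ∧ T.degree v = 1).card ≤
      (univ.filter fun v => T.dist c v = 1).card) :
    Set.InjOn p {v | 2 ≤ T.dist c v} := by
  have h1 : Set.SurjOn p ((univ.filter fun v => 2 ≤ T.dist c v : Finset V) : Set V)
      ((univ.filter fun v => v ≠ c ∧ T.degree v ≠ 1 : Finset V) : Set V) := by
    intro v hv
    simp only [coe_filter, mem_univ, true_and, Set.mem_ofPred_eq] at hv
    obtain ⟨u, hu, rfl⟩ := h.exists_child hv.1 hv.2
    refine ⟨u, ?_, rfl⟩
    have a := (h.1 u hu).2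
    have b := (h.1 _ hv.1).2
    simp; omega
  have h2 : Set.MapsTo p ((univ.filter fun v => 2 ≤ T.dist c v : Finset V) : Set V)
      ((univ.filter fun v => v ≠ c ∧ T.degree v ≠ 1 : Finset V) : Set V) := by
    intro v hv
    simp only [coe_filter, mem_univ, true_and, Set.mem_ofPred_eq] at hv ⊢
    have hvc : v ≠ c := by rintro rfl; simp at hv
    have a := (h.1 v hvc).2
    have hpc : p v ≠ c := by intro e; rw [e, dist_self] at a; omega
    refine ⟨hpc, ?_⟩
    rw [h.degree_eq, if_neg hpc]
    have : 0 < (univ.filter fun u => u ≠ c ∧ p u = p v).card :=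
      card_pos.mpr ⟨v, by simp [hvc]⟩
    omega
  have k1 : (univ.filter fun v => v ≠ c ∧ T.degree v = 1).card +
      (univ.filter fun v => v ≠ c ∧ T.degree v ≠ 1).card = (univ.erase c).card := by
    rw [← card_union_of_disjoint]
    · congr 1; ext v; simp; tauto
    · rw [Finset.disjoint_left]; intro v; simp; tauto
  have k2 : (univ.filter fun v => T.dist c v = 1).card +
      (univ.filter fun v => 2 ≤ T.dist c v).card = (univ.erase c).card := by
    rw [← card_union_of_disjoint]
    · congr 1; ext v
      simp only [mem_union, mem_filter, mem_univ, true_and, mem_erase, and_true, ne_eq]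
      rw [eq_comm (a := v), ← hT.connected.dist_eq_zero_iff]
      omega
    · rw [Finset.disjoint_left]; intro v
      simp only [mem_filter, mem_univ, true_and]
      omega
  have := Finset.injOn_of_surjOn_of_card_le p h2 h1 (by omega)
  simpa using this

theorem exists_order {A B : Finset V} (hAB : A ⊆ B) :
    ∃ s : V → ℕ, Set.InjOn s B ∧ (∀ x ∈ B, s x < B.card) ∧ ∀ x ∈ A, s x < A.card := by
  have hd : (B \ A).card + A.card = B.card := card_sdiff_add_card_eq_card hAB
  refine ⟨fun x => if hx : x ∈ A then A.equivFin ⟨x, hx⟩ else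
    if hy : x ∈ B \ A then A.card + (B \ A).equivFin ⟨x, hy⟩ else 0, ?_, ?_, ?_⟩
  · intro x hx y hy hxy
    simp only [mem_coe] at hx hy
    by_cases h1 : x ∈ A <;> by_cases h2 : y ∈ A
    · simp [h1, h2, Fin.val_inj] at hxy; exact hxy
    · have : y ∈ B \ A := by simp [hy, h2]
      simp only [h1, h2, this, dite_true, dite_false] at hxy
      have := (A.equivFin ⟨x, h1⟩).isLt
      omega
    · have : x ∈ B \ A := by simp [hx, h1]
      simp only [h1, h2, this, dite_true, dite_false] at hxy
      have := (A.equivFin ⟨y, h2⟩).isLt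
      omega
    · have k1 : x ∈ B \ A := by simp [hx, h1]
      have k2 : y ∈ B \ A := by simp [hy, h2]
      simp only [h1, h2, k1, k2, dite_true, dite_false, add_right_inj, Fin.val_inj,
        EmbeddingLike.apply_eq_iff_eq, Subtype.mk.injEq] at hxy
      exact hxy
  · intro x hx
    by_cases h1 : x ∈ A
    · simp only [h1, dite_true]
      have := (A.equivFin ⟨x, h1⟩).isLt
      omega
    · have k1 : x ∈ B \ A := by simp [hx, h1]
      simp only [h1, k1, dite_true, dite_false]
      have := ((B \ A).equivFin ⟨x, k1⟩).isLt
      omega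
  · intro x h1
    simp only [h1, dite_true]
    exact (A.equivFin ⟨x, h1⟩).isLt

end levels

/-! ### The spider -/

theorem card_fin_filter (n : ℕ) (P : ℕ → Prop) [DecidablePred P]
    [DecidablePred fun v : Fin n => P v.val] :
    (univ.filter fun v : Fin n => P v.val).card = ((range n).filter P).card := by
  rw [← card_map Fin.valEmbedding]
  congr 1
  ext a
  simp only [mem_map, mem_filter, mem_univ, true_and, Fin.valEmbedding_apply, mem_range]
  constructor
  · rintro ⟨v, hv, rfl⟩; exact ⟨v.isLt, hv⟩
  · rintro ⟨h1, h2⟩; exact ⟨⟨a, h1⟩, h2, rfl⟩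

theorem spider_adj (n r : ℕ) (u v : Fin n) :
    (spiderS n r).Adj u v ↔ u ≠ v ∧ (u.val - r = v.val ∨ v.val - r = u.val) := by
  have key : ∀ x : ℕ, (if x ≤ r then 0 else x - r) = x - r := by
    intro x; split_ifs <;> omega
  simp only [spiderS, parentGraph, SimpleGraph.fromRel_adj, key]

theorem spider_walk (n r : ℕ) (hn : 0 < n) (hr : 1 ≤ r) (i : ℕ) :
    ∀ v : Fin n, v.val ≤ i * r → ∃ w : (spiderS n r).Walk ⟨0, hn⟩ v, w.length ≤ i := by
  induction i with
  | zero =>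
    intro v hv
    have : v = ⟨0, hn⟩ := by ext; simpa using hv
    subst this
    exact ⟨Walk.nil, by simp⟩
  | succ i ih =>
    intro v hv
    by_cases h0 : v.val = 0
    · have : v = ⟨0, hn⟩ := by ext; simpa using h0
      subst this
      exact ⟨Walk.nil, by simp⟩
    · rw [add_mul] at hv
      obtain ⟨w, hw⟩ := ih ⟨v.val - r, by omega⟩ (by simp only; omega)
      have ha : (spiderS n r).Adj ⟨v.val - r, by omega⟩ v := by
        rw [spider_adj]
        refine ⟨?_, Or.inr rfl⟩
        intro h
        have := congrArg Fin.val h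
        simp only at this
        omega
      exact ⟨w.concat ha, by rw [Walk.length_concat]; omega⟩

theorem spider_isTree (n r : ℕ) (hn : 0 < n) (hr : 1 ≤ r) : (spiderS n r).IsTree := by
  have hc : (spiderS n r).Connected := by
    rw [connected_iff_exists_forall_reachable]
    refine ⟨⟨0, hn⟩, fun v => ?_⟩
    obtain ⟨w, _⟩ := spider_walk n r hn hr v.val v (Nat.le_mul_of_pos_right _ hr)
    exact ⟨w⟩
  rw [isTree_iff_connected_and_card]
  refine ⟨hc, ?_⟩
  have h1 := hc.card_vert_le_card_edgeSet_add_one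
  have h2 : (spiderS n r).edgeFinset ⊆ (univ.erase (⟨0, hn⟩ : Fin n)).image
      (fun v => s(v, ⟨v.val - r, by omega⟩)) := by
    intro x
    induction x with
    | _ a b =>
      rw [mem_edgeFinset, mem_edgeSet, spider_adj]
      simp only [Finset.mem_image, mem_erase, mem_univ, and_true, Sym2.eq_iff, ne_eq]
      rintro ⟨h1, h2⟩
      rw [Fin.ext_iff] at h1
      rcases h2 with h2 | h2
      · exact ⟨a, by rw [Fin.ext_iff]; simp only; omega, Or.inl ⟨rfl, Fin.ext h2⟩⟩
      · exact ⟨b, by rw [Fin.ext_iff]; simp only; omega, Or.inr ⟨rfl, Fin.ext h2⟩⟩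
  have h3 := (card_le_card h2).trans card_image_le
  rw [card_erase_of_mem (mem_univ _), Finset.card_univ, Fintype.card_fin] at h3
  rw [Nat.card_eq_fintype_card, Nat.card_eq_fintype_card, Fintype.card_fin] at *
  rw [edgeFinset_card] at h3
  omega

theorem spider_odd_iff (n k : ℕ) (hn : 0 < n) (hk : 1 ≤ k) (hkn : 2 * k ≤ n) (v : Fin n) :
    Odd ((spiderS n (2 * k)).degree v) ↔ n ≤ v.val + 2 * k := by
  rw [← card_neighborFinset_eq_degree, neighborFinset_eq_filter]
  simp only [spider_adj]
  by_cases h0 : v.val = 0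
  · have : (univ.filter fun w : Fin n => v ≠ w ∧ (v.val - 2 * k = w.val ∨ w.val - 2 * k = v.val)) =
        univ.filter fun w : Fin n => (fun x => 1 ≤ x ∧ x ≤ 2 * k) w.val := by
      ext w; simp [Fin.ext_iff]; omega
    rw [this, card_fin_filter n (fun x => 1 ≤ x ∧ x ≤ 2 * k)]
    by_cases hlt : 2 * k < n
    · have : (range n).filter (fun x => 1 ≤ x ∧ x ≤ 2 * k) = Finset.Icc 1 (2 * k) := by
        ext x; simp; omega
      rw [this, Nat.card_Icc, Nat.odd_iff]; omega
    · have : (range n).filter (fun x => 1 ≤ x ∧ x ≤ 2 * k) = Finset.Ico 1 n := by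
        ext x; simp; omega
      rw [this, Nat.card_Ico, Nat.odd_iff]; omega
  · by_cases hlt : v.val + 2 * k < n
    · have : (univ.filter fun w : Fin n =>
          v ≠ w ∧ (v.val - 2 * k = w.val ∨ w.val - 2 * k = v.val)) =
          {⟨v.val - 2 * k, by omega⟩, ⟨v.val + 2 * k, hlt⟩} := by
        ext w; simp [Fin.ext_iff]; omega
      rw [this, card_pair (by rw [ne_eq, Fin.ext_iff]; simp only; omega), Nat.odd_iff]; omega
    · have : (univ.filter fun w : Fin n =>
          v ≠ w ∧ (v.val - 2 * k = w.val ∨ w.val - 2 * k = v.val)) =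
          {⟨v.val - 2 * k, by omega⟩} := by
        ext w; simp [Fin.ext_iff]; omega
      rw [this, card_singleton, Nat.odd_iff]; omega

theorem spider_odd (n k : ℕ) (hn : 0 < n) (hk : 1 ≤ k) (hkn : 2 * k ≤ n) :
    oddDegreeCount (spiderS n (2 * k)) = 2 * k := by
  unfold oddDegreeCount
  have : (univ.filter fun v => Odd ((spiderS n (2 * k)).degree v)) =
      univ.filter fun v : Fin n => (fun x => n ≤ x + 2 * k) v.val := by
    apply Finset.filter_congr
    intro v _
    exact spider_odd_iff n k hn hk hkn v
  rw [this, card_fin_filter n (fun x => n ≤ x + 2 * k)]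
  have : (range n).filter (fun x => n ≤ x + 2 * k) = Finset.Ico (n - 2 * k) n := by
    ext x; simp; omega
  rw [this, Nat.card_Ico]; omega

theorem spider_totD (n r : ℕ) (hn : 0 < n) (hr : 1 ≤ r) :
    totD (spiderS n r) ⟨0, hn⟩ ≤ ∑ i ∈ range n, ((n : ℤ) - (min n (1 + i * r) : ℕ)) := by
  rw [totD_eq (spider_isTree n r hn hr), Fintype.card_fin]
  apply Finset.sum_le_sum
  intro i _
  have h1 : ((range n).filter (fun x => x ≤ i * r)).card = min n (1 + i * r) := by
    have : (range n).filter (fun x => x ≤ i * r) = range (min n (1 + i * r)) := by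
      ext x; simp; omega
    rw [this, card_range]
  rw [← card_fin_filter] at h1
  have h2 : (univ.filter fun v : Fin n => v.val ≤ i * r).card ≤
      (univ.filter fun v => (spiderS n r).dist ⟨0, hn⟩ v ≤ i).card := by
    apply card_le_card
    intro v
    simp only [mem_filter, mem_univ, true_and]
    intro hv
    obtain ⟨w, hw⟩ := spider_walk n r hn hr i v hv
    exact (SimpleGraph.dist_le w).trans hw
  omega

/-! ### Building the isomorphism -/

theorem IsPar.leg_level {V : Type*} {T : SimpleGraph V} {c : V} {p : V → V}
    (h : IsPar T c p) (m : ℕ) : ∀ v, T.dist c v = m + 1 → T.dist c (p^[m] v) = 1 := by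
  induction m with
  | zero => intro v hv; simpa using hv
  | succ m ih =>
    intro v hv
    have hvc : v ≠ c := by rintro rfl; simp at hv
    rw [Function.iterate_succ_apply]
    apply ih
    have := (h.1 v hvc).2
    omega

theorem IsPar.leg_inj {V : Type*} {T : SimpleGraph V} {c : V} {p : V → V}
    (h : IsPar T c p) (hinj : Set.InjOn p {v | 2 ≤ T.dist c v}) (m : ℕ) :
    ∀ u v, T.dist c u = m + 1 → T.dist c v = m + 1 → p^[m] u = p^[m] v → u = v := by
  induction m with
  | zero => intro u v _ _ huv; simpa using huv
  | succ m ih =>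
    intro u v hu hv huv
    have huc : u ≠ c := by rintro rfl; simp at hu
    have hvc : v ≠ c := by rintro rfl; simp at hv
    rw [Function.iterate_succ_apply, Function.iterate_succ_apply] at huv
    have a := (h.1 u huc).2
    have b := (h.1 v hvc).2
    have := ih (p u) (p v) (by omega) (by omega) huv
    exact hinj (by rw [Set.mem_ofPred_eq]; omega) (by rw [Set.mem_ofPred_eq]; omega) this

theorem spider_iso (n r : ℕ) (hn : 2 ≤ n) (hr : 2 ≤ r) {V : Type*} [Fintype V]
    (hV : Fintype.card V = n) (T : SimpleGraph V) (hT : T.IsTree) {c : V} {p : V → V} (h : IsPar T c p)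
    (hleaf : (univ.filter fun v => v ≠ c ∧ T.degree v = 1).card ≤ r)
    (hD : totD T c ≤ ∑ i ∈ range n, ((n : ℤ) - (min n (1 + i * r) : ℕ))) :
    Nonempty (T ≃g spiderS n r) := by
  have hball : ∀ i, i < n →
      (univ.filter fun v => T.dist c v ≤ i).card = min n (1 + i * r) := by
    intro i hi
    have := h.ball_eq hT hleaf (by rw [hV]; exact hD) i (by rw [hV]; exact hi)
    rw [hV] at this
    exact this
  obtain ⟨M, hM⟩ : ∃ M, M = (n - 1) / r := ⟨_, rfl⟩
  have hM1 : M * r ≤ n - 1 := by rw [hM]; exact Nat.div_mul_le_self _ _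
  have hM2 : n - 1 < (M + 1) * r := by
    rw [hM, mul_comm]; exact Nat.lt_mul_div_succ _ (by omega)
  have hM3 : M + 1 < n := by
    rcases Nat.eq_zero_or_pos M with h0 | h0
    · omega
    · have : M * 2 ≤ M * r := Nat.mul_le_mul_left _ hr
      omega
  have e0 := ball_zero' hT c
  have e1 := ball_succ T c 0
  rw [e0, zero_add, hball 1 (by omega), one_mul] at e1
  have e2 := ball_succ T c M
  rw [hball (M + 1) hM3, hball M (by omega)] at e2
  have hlev : ∀ v, T.dist c v ≤ M + 1 := by
    have h1 : (univ.filter fun v => T.dist c v ≤ M + 1).card = Fintype.card V := by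
      rw [hball _ hM3, hV]; omega
    intro v
    have h2 := Finset.card_eq_iff_eq_univ _ |>.mp h1
    have := mem_univ v
    rw [← h2] at this
    simpa using this
  have hinj : Set.InjOn p {v | 2 ≤ T.dist c v} := by
    by_cases hlt : r < n
    · exact h.injOn hT (by omega)
    · intro u hu
      have := hlev u
      rw [Set.mem_ofPred_eq] at hu
      have : M = 0 := by rw [hM]; exact Nat.div_eq_of_lt (by omega)
      omega
  have hd : ∀ v, v ≠ c → 1 ≤ T.dist c v := fun v hv => by
    have := (h.1 v hv).2
    omega
  set leg : V → V := fun v => p^[T.dist c v - 1] v with hleg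
  set B : Finset V := univ.filter fun v => T.dist c v = 1 with hB
  set A : Finset V := (univ.filter fun v => T.dist c v = M + 1).image leg with hA
  have hlegB : ∀ v, v ≠ c → leg v ∈ B := by
    intro v hv
    rw [hB, mem_filter]
    refine ⟨mem_univ _, h.leg_level _ v ?_⟩
    have := hd v hv
    omega
  have hAB : A ⊆ B := by
    intro x hx
    rw [hA, Finset.mem_image] at hx
    obtain ⟨v, hv, rfl⟩ := hx
    apply hlegB
    rintro rfl
    simp at hv
  obtain ⟨s, hs1, hs2, hs3⟩ := exists_order hAB
  have hAc : A.card ≤ n - 1 - M * r := by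
    refine card_image_le.trans ?_
    omega
  have hBc : B.card ≤ r := by omega
  have hs4 : ∀ v, v ≠ c → s (leg v) < r := fun v hv => (hs2 _ (hlegB v hv)).trans_le hBc
  set f : V → ℕ := fun v => if v = c then 0 else r * (T.dist c v - 1) + s (leg v) + 1 with hf
  have fc : f c = 0 := by simp [hf]
  have fv : ∀ v, v ≠ c → f v = r * (T.dist c v - 1) + s (leg v) + 1 := by
    intro v hv; simp [hf, hv]
  have hfn : ∀ v, f v < n := by
    intro v
    by_cases hv : v = c
    · rw [hv, fc]; omega
    · rw [fv v hv]
      by_cases hL : T.dist c v = M + 1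
      · have h1 : leg v ∈ A := by
          rw [hA, Finset.mem_image]
          exact ⟨v, by simpa using hL, rfl⟩
        have h2 := hs3 _ h1
        rw [hL, Nat.add_sub_cancel, mul_comm]
        omega
      · have h1 := hlev v
        have h2 := hs4 v hv
        have h4 := hd v hv
        have h3 : (T.dist c v - 1 + 1) * r ≤ M * r := Nat.mul_le_mul_right _ (by omega)
        rw [add_mul, one_mul] at h3
        rw [mul_comm]
        omega
  have hfinj : Function.Injective f := by
    intro u v huv
    by_cases hu : u = c <;> by_cases hv : v = c
    · rw [hu, hv]
    · rw [hu, fc, fv v hv] at huv; omega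
    · rw [hv, fc, fv u hu] at huv; omega
    · rw [fv u hu, fv v hv] at huv
      have a := hs4 u hu
      have b := hs4 v hv
      have huv' : r * (T.dist c u - 1) + s (leg u) = r * (T.dist c v - 1) + s (leg v) := by omega
      have q1 := congrArg (· / r) huv'
      have q2 := congrArg (· % r) huv'
      simp only [Nat.mul_add_div (show 0 < r by omega), Nat.mul_add_mod, Nat.div_eq_of_lt a,
        Nat.div_eq_of_lt b, Nat.mod_eq_of_lt a, Nat.mod_eq_of_lt b, add_zero] at q1 q2
      have q3 := hs1 (hlegB u hu) (hlegB v hv) q2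
      have c1 := hd u hu
      have c2 := hd v hv
      refine h.leg_inj hinj (T.dist c u - 1) u v (by omega) (by omega) ?_
      have q4 : p^[T.dist c u - 1] u = p^[T.dist c v - 1] v := q3
      rw [q4, q1]
  have hfp : ∀ u, u ≠ c → f u - r = f (p u) := by
    intro u hu
    have a := (h.1 u hu).2
    have b := hs4 u hu
    rw [fv u hu]
    by_cases hp : p u = c
    · rw [hp, fc]
      rw [hp, SimpleGraph.dist_self] at a
      rw [a]; simp; omega
    · rw [fv _ hp]
      have b2 := hd _ hp
      have hl : leg u = leg (p u) := by
        simp only [hleg]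
        rw [a, Nat.add_sub_cancel]
        obtain ⟨m, hm⟩ : ∃ m, T.dist c (p u) = m + 1 := ⟨_, (Nat.sub_add_cancel b2).symm⟩
        rw [hm, Function.iterate_succ_apply, Nat.add_sub_cancel]
      rw [hl, a, Nat.add_sub_cancel]
      obtain ⟨m, hm⟩ : ∃ m, T.dist c (p u) = m + 1 := ⟨_, (Nat.sub_add_cancel b2).symm⟩
      rw [hm, Nat.add_sub_cancel, mul_add, mul_one]
      omega
  have hstep : ∀ u v, u ≠ v → (f u - r = f v ↔ u ≠ c ∧ p u = v) := by
    intro u v huv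
    by_cases hu : u = c
    · rw [hu, fc, Nat.zero_sub, ← fc, hfinj.eq_iff]
      rw [hu] at huv
      simp [huv]
    · rw [hfp u hu, hfinj.eq_iff]
      simp [hu]
  let φ : V → Fin n := fun v => ⟨f v, hfn v⟩
  have hφ : Function.Injective φ := fun u v huv => hfinj (congrArg Fin.val huv)
  refine ⟨⟨Equiv.ofBijective φ 
    ((Fintype.bijective_iff_injective_and_card φ).mpr ⟨hφ, by rw [hV, Fintype.card_fin]⟩), ?_⟩⟩
  intro u v
  simp only [Equiv.ofBijective_apply]
  rw [spider_adj, h.adj_iff, ne_eq, hφ.eq_iff]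
  change ¬u = v ∧ (f u - r = f v ∨ f v - r = f u) ↔ _
  by_cases huv : u = v
  · subst huv
    simp only [not_true_eq_false, false_and, or_self, false_iff, not_and]
    intro h1 h2
    have := (h.1 u h1).2
    rw [h2] at this
    omega
  · rw [hstep u v huv, hstep v u (Ne.symm huv)]
    simp [huv]

/-- the tree maximizing the Mostar index among trees of order n with
exactly 2k odd vertices (1 ≤ k ≤ ⌊n/2⌋) is S_{n,2k}. -/
theorem max_mostar_odd_vertices (n k : ℕ) (hk1 : 1 ≤ k) (hk2 : k ≤ n / 2)
    (T : SimpleGraph (Fin n)) (hT : T.IsTree) (hodd : oddDegreeCount T = 2 * k)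
    (hmax : ∀ T' : SimpleGraph (Fin n), T'.IsTree → oddDegreeCount T' = 2 * k →
      mostar T' ≤ mostar T) :
    Nonempty (T ≃g spiderS n (2 * k)) := by
  have hn : 0 < n := by omega
  have hkn : 2 * k ≤ n := by omega
  have hS := hmax (spiderS n (2 * k)) (spider_isTree n _ hn (by omega))
    (spider_odd n k hn hk1 hkn)
  obtain ⟨c, hc⟩ := mostar_centroid hT
  obtain ⟨p, h⟩ := exists_isPar hT c
  have h1 := mostar_ge (spider_isTree n (2 * k) hn (by omega)) ⟨0, hn⟩
  have h2 := spider_totD n (2 * k) hn (by omega)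
  rw [Fintype.card_fin] at hc h1
  have hS' : (mostar (spiderS n (2 * k)) : ℤ) ≤ mostar T := by exact_mod_cast hS
  refine spider_iso n (2 * k) (by omega) (by omega) (Fintype.card_fin n) T hT h ?_ (by linarith)
  rw [← hodd]
  apply card_le_card
  intro v
  simp only [mem_filter, mem_univ, true_and]
  rintro ⟨_, hv⟩
  rw [hv]
  exact odd_one
end
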